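/- Let ρ^{AB}, ρ^{CD} be two-qubit density matrices with Bloch coefficient matrices R^{AB}, R^{CD} (R_{ij} = Tr[ρ(σ_i⊗σ_j)]), and let E^{BC} be a positive semidefinite operator on ℂ²⊗ℂ² with coefficient matrix 𝔯_{kl} = (1/4)Tr[E(σ_k⊗σ_l)]. Then the unnormalized post-swapping operator Tr_{BC}[(ρ^{AB}⊗ρ^{CD})(𝟙^A ⊗ E^{BC} ⊗ 𝟙^D)] equals (1/4) Σ_{i,n} (R^{AB} 𝔯 R^{CD})_{in} σ_i^A ⊗ σ_n^D. -/

import Mathlib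

open Matrix Kronecker ComplexOrder

/-- Pauli matrices, with `σ 0 = I`. -/
noncomputable def σ : Fin 4 → Matrix (Fin 2) (Fin 2) ℂ :=
  ![1, !![0, 1; 1, 0], !![0, -Complex.I; Complex.I, 0], !![1, 0; 0, -1]]

/-- Partial trace over the middle two qubits B and C, with tensor ordering A⊗B⊗C⊗D. -/
noncomputable def trBC
    (X : Matrix (Fin 2 × Fin 2 × Fin 2 × Fin 2) (Fin 2 × Fin 2 × Fin 2 × Fin 2) ℂ) :
    Matrix (Fin 2 × Fin 2) (Fin 2 × Fin 2) ℂ :=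
  Matrix.of fun p q => ∑ b : Fin 2, ∑ c : Fin 2, X (p.1, b, c, p.2) (q.1, b, c, q.2)

/-- The four-qubit operator ρ^{AB} ⊗ ρ^{CD}. -/
noncomputable def stateABCD (ρAB ρCD : Matrix (Fin 2 × Fin 2) (Fin 2 × Fin 2) ℂ) :
    Matrix (Fin 2 × Fin 2 × Fin 2 × Fin 2) (Fin 2 × Fin 2 × Fin 2 × Fin 2) ℂ :=
  Matrix.of fun x y =>
    ρAB (x.1, x.2.1) (y.1, y.2.1) * ρCD (x.2.2.1, x.2.2.2) (y.2.2.1, y.2.2.2)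

/-- The four-qubit operator 𝟙^A ⊗ E^{BC} ⊗ 𝟙^D. -/
noncomputable def opBC (E : Matrix (Fin 2 × Fin 2) (Fin 2 × Fin 2) ℂ) :
    Matrix (Fin 2 × Fin 2 × Fin 2 × Fin 2) (Fin 2 × Fin 2 × Fin 2 × Fin 2) ℂ :=
  Matrix.of fun x y =>
    (if x.1 = y.1 then 1 else 0) * E (x.2.1, x.2.2.1) (y.2.1, y.2.2.1) *
      (if x.2.2.2 = y.2.2.2 then 1 else 0)

/-- Contracting the first Pauli index of `Tr[X (σ i ⊗ M)]` recovers a partial trace of `X`. -/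
lemma sum_trace_kronecker_left (X : Matrix (Fin 2 × Fin 2) (Fin 2 × Fin 2) ℂ)
    (M : Matrix (Fin 2) (Fin 2) ℂ) (a a' : Fin 2) :
    ∑ i, (X * (σ i ⊗ₖ M)).trace * σ i a a' =
      2 * ∑ b, ∑ b', X (a, b) (a', b') * M b' b := by
  fin_cases a <;> fin_cases a' <;>
    simp [trace, mul_apply, Fintype.sum_prod_type, Fin.sum_univ_succ, σ, kroneckerMap_apply] <;>
    ring_nf <;> simp only [Complex.I_sq] <;> ring

/-- Contracting the second Pauli index of `Tr[X (M ⊗ σ n)]` recovers a partial trace of `X`. -/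
lemma sum_trace_kronecker_right (X : Matrix (Fin 2 × Fin 2) (Fin 2 × Fin 2) ℂ)
    (M : Matrix (Fin 2) (Fin 2) ℂ) (d d' : Fin 2) :
    ∑ n, (X * (M ⊗ₖ σ n)).trace * σ n d d' =
      2 * ∑ c, ∑ c', X (c, d) (c', d') * M c' c := by
  fin_cases d <;> fin_cases d' <;>
    simp [trace, mul_apply, Fintype.sum_prod_type, Fin.sum_univ_succ, σ, kroneckerMap_apply] <;>
    ring_nf <;> simp only [Complex.I_sq] <;> ring

/-- Completeness of the Pauli matrices. -/
lemma sum_pauli_mul_pauli (a b c d : Fin 2) :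
    ∑ k, σ k a b * σ k c d = if a = d ∧ b = c then 2 else 0 := by
  fin_cases a <;> fin_cases b <;> fin_cases c <;> fin_cases d <;>
    norm_num [Fin.sum_univ_succ, σ]

/-- Pauli expansion of a two-qubit operator, entrywise. -/
lemma pauli_expansion (X : Matrix (Fin 2 × Fin 2) (Fin 2 × Fin 2) ℂ) (b b' c c' : Fin 2) :
    ∑ k, ∑ l, (1 / 4 : ℂ) * (X * (σ k ⊗ₖ σ l)).trace * (σ k b b' * σ l c c') =
      X (b, c) (b', c') := by
  calc _ = (1 / 4 : ℂ) * ∑ k, σ k b b' * ∑ l, (X * (σ k ⊗ₖ σ l)).trace * σ l c c' := by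
        simp only [Finset.mul_sum]
        exact Finset.sum_congr rfl fun k _ => Finset.sum_congr rfl fun l _ => by ring
    _ = (1 / 2 : ℂ) * ∑ e, ∑ e', X (e, c) (e', c') * ∑ k, σ k b b' * σ k e' e := by
        simp only [sum_trace_kronecker_right, Fin.sum_univ_two, Finset.mul_sum,
          ← Finset.sum_add_distrib]
        exact Finset.sum_congr rfl fun k _ => by ring
    _ = _ := by
        simp only [sum_pauli_mul_pauli, ite_and]
        simp
        ring

theorem stmt2 (ρAB ρCD E : Matrix (Fin 2 × Fin 2) (Fin 2 × Fin 2) ℂ)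
    (hAB : ρAB.PosSemidef) (hABtr : ρAB.trace = 1)
    (hCD : ρCD.PosSemidef) (hCDtr : ρCD.trace = 1)
    (hE : E.PosSemidef)
    (RAB RCD rBC : Matrix (Fin 4) (Fin 4) ℂ)
    (hRAB : ∀ i j, RAB i j = (ρAB * (σ i ⊗ₖ σ j)).trace)
    (hRCD : ∀ i j, RCD i j = (ρCD * (σ i ⊗ₖ σ j)).trace)
    (hr : ∀ k l, rBC k l = (1/4 : ℂ) * (E * (σ k ⊗ₖ σ l)).trace) :
    trBC (stateABCD ρAB ρCD * opBC E)
      = (1/4 : ℂ) • ∑ i : Fin 4, ∑ n : Fin 4,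
          (RAB * rBC * RCD) i n • (σ i ⊗ₖ σ n) := by
  ext ⟨a, d⟩ ⟨a', d'⟩
  have hA (j) : ∑ i, RAB i j * σ i a a' = 2 * ∑ b, ∑ b', ρAB (a, b) (a', b') * σ j b' b := by
    simp only [hRAB, sum_trace_kronecker_left]
  have hD (m) : ∑ n, RCD m n * σ n d d' = 2 * ∑ c, ∑ c', ρCD (c, d) (c', d') * σ m c' c := by
    simp only [hRCD, sum_trace_kronecker_right]
  have hBC (b b' c c') : ∑ j, ∑ m, rBC j m * (σ j b' b * σ m c' c) = E (b', c') (b, c) := by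
    simp only [hr, pauli_expansion]
  have hrhs : ((1 / 4 : ℂ) • ∑ i, ∑ n, (RAB * rBC * RCD) i n • (σ i ⊗ₖ σ n)) (a, d) (a', d') =
      (1 / 4 : ℂ) * ∑ j, ∑ m,
        rBC j m * ((∑ i, RAB i j * σ i a a') * ∑ n, RCD m n * σ n d d') := by
    have h : (fun i => σ i a a') ⬝ᵥ ((RAB * rBC * RCD) *ᵥ fun n => σ n d d') =
        ((fun i => σ i a a') ᵥ* RAB) ⬝ᵥ (rBC *ᵥ (RCD *ᵥ fun n => σ n d d')) := by
      rw [← dotProduct_mulVec, mulVec_mulVec, mulVec_mulVec, Matrix.mul_assoc]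
    simp only [Matrix.smul_apply, Matrix.sum_apply, kroneckerMap_apply, smul_eq_mul]
    congr 1
    calc _ = (fun i => σ i a a') ⬝ᵥ ((RAB * rBC * RCD) *ᵥ fun n => σ n d d') := by
          simp only [dotProduct, mulVec, Finset.mul_sum]
          exact Finset.sum_congr rfl fun i _ => Finset.sum_congr rfl fun n _ => by ring
      _ = _ := by
          rw [h]
          simp only [dotProduct, mulVec, vecMul]
          refine Finset.sum_congr rfl fun j _ => ?_
          rw [Finset.mul_sum]
          refine Finset.sum_congr rfl fun m _ => ?_
          simp only [mul_comm (σ _ a a')]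
          ring
  rw [hrhs]
  simp only [hA, hD]
  have hlhs : trBC (stateABCD ρAB ρCD * opBC E) (a, d) (a', d') =
      ∑ b, ∑ c, ∑ b', ∑ c',
        ρAB (a, b) (a', b') * ρCD (c, d) (c', d') * E (b', c') (b, c) := by
    simp [trBC, stateABCD, opBC, mul_apply, Fintype.sum_prod_type]
  rw [hlhs]
  simp only [← hBC, Finset.mul_sum, Finset.sum_mul]
  simp only [Fin.sum_univ_two, ← Finset.sum_add_distrib]
  exact Finset.sum_congr rfl fun j _ => Finset.sum_congr rfl fun m _ => by ring
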